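/- Let n ≥ 2 and let Φ₀, Φ₁ ∈ H, not both zero, satisfy ⟨Φ₀, Φ₁⟩ = 0 and ⟨Φ₀, γ(v)Φ₁⟩ = 0 for every v ∈ ℝⁿ. Set φ = ψ⁻_{Φ₀} + ψ⁺_{Φ₁}. Then φ attains the critical value of the second spinorial Sobolev quotient: (∫_{ℝⁿ} ‖Dφ(x)‖^{2n/(n+1)} dx)^{(n+1)/n} = (n²/4) · ωₙ^{2/n} · (∫_{ℝⁿ} ‖φ(x)‖^{2n/(n−1)} dx)^{(n−1)/n}, where both integrals are finite. -/

import Mathlib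

open scoped RealInnerProductSpace
open MeasureTheory

noncomputable section

/-- The Dirac operator on spinor fields `ψ : ℝⁿ → H`, relative to Clifford
multiplication `γ` and the standard orthonormal basis of `ℝⁿ`. -/
def Dirac {n : ℕ} {H : Type*} [NormedAddCommGroup H] [InnerProductSpace ℝ H]
    (γ : EuclideanSpace ℝ (Fin n) →ₗ[ℝ] H →ₗ[ℝ] H)
    (ψ : EuclideanSpace ℝ (Fin n) → H) (x : EuclideanSpace ℝ (Fin n)) : H :=
  ∑ i : Fin n, γ (EuclideanSpace.single i (1 : ℝ))
    (fderiv ℝ ψ x (EuclideanSpace.single i (1 : ℝ)))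

/-- The spinor bubble `ψ⁻_Φ(x) = (2/(1+‖x‖²))^{n/2} (Φ − γ(x)Φ)`. -/
def psiNeg {n : ℕ} {H : Type*} [NormedAddCommGroup H] [InnerProductSpace ℝ H]
    (γ : EuclideanSpace ℝ (Fin n) →ₗ[ℝ] H →ₗ[ℝ] H)
    (Φ : H) (x : EuclideanSpace ℝ (Fin n)) : H :=
  (((2 / (1 + ‖x‖ ^ 2) : ℝ)) ^ ((n : ℝ) / 2)) • (Φ - γ x Φ)

/-- The spinor bubble `ψ⁺_Φ(x) = (2/(1+‖x‖²))^{n/2} (Φ + γ(x)Φ)`. -/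
def psiPos {n : ℕ} {H : Type*} [NormedAddCommGroup H] [InnerProductSpace ℝ H]
    (γ : EuclideanSpace ℝ (Fin n) →ₗ[ℝ] H →ₗ[ℝ] H)
    (Φ : H) (x : EuclideanSpace ℝ (Fin n)) : H :=
  (((2 / (1 + ‖x‖ ^ 2) : ℝ)) ^ ((n : ℝ) / 2)) • (Φ + γ x Φ)

/-- The volume `ωₙ = 2 π^{(n+1)/2} / Γ((n+1)/2)` of the round unit `n`-sphere. -/
def sphereVol (n : ℕ) : ℝ :=
  2 * Real.pi ^ (((n : ℝ) + 1) / 2) / Real.Gamma (((n : ℝ) + 1) / 2)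

/-- The integral of a power of `1 + ‖x‖ ^ 2` over a finite-dimensional inner product space. -/
theorem integral_one_add_norm_sq_rpow_neg {V : Type*} [NormedAddCommGroup V]
    [InnerProductSpace ℝ V] [FiniteDimensional ℝ V] [MeasurableSpace V] [BorelSpace V]
    {s : ℝ} (hs : (Module.finrank ℝ V : ℝ) / 2 < s) :
    ∫ x : V, (1 + ‖x‖ ^ 2) ^ (-s) =
      Real.pi ^ ((Module.finrank ℝ V : ℝ) / 2) *
        Real.Gamma (s - (Module.finrank ℝ V : ℝ) / 2) / Real.Gamma s := by
  set d : ℝ := (Module.finrank ℝ V : ℝ) / 2 with hd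
  have hd0 : 0 ≤ d := by positivity
  have hs0 : 0 < s := hd0.trans_lt hs
  have hΓ : Real.Gamma s ≠ 0 := (Real.Gamma_pos_of_pos hs0).ne'
  have hinner (x : V) : ∫ t in Set.Ioi (0 : ℝ),
      t ^ (s - 1) * Real.exp (-((1 + ‖x‖ ^ 2) * t)) =
        Real.Gamma s * (1 + ‖x‖ ^ 2) ^ (-s) := by
    rw [Real.integral_rpow_mul_exp_neg_mul_Ioi hs0 (by positivity), one_div,
      Real.inv_rpow (by positivity), ← Real.rpow_neg (by positivity), mul_comm]
  have hmeas : AEStronglyMeasurable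
      (Function.uncurry fun (x : V) (t : ℝ) =>
        t ^ (s - 1) * Real.exp (-((1 + ‖x‖ ^ 2) * t)))
      ((volume : Measure V).prod (volume.restrict (Set.Ioi (0 : ℝ)))) := by
    apply Measurable.aestronglyMeasurable
    unfold Function.uncurry
    fun_prop
  have hint : Integrable
      (Function.uncurry fun (x : V) (t : ℝ) =>
        t ^ (s - 1) * Real.exp (-((1 + ‖x‖ ^ 2) * t)))
      ((volume : Measure V).prod (volume.restrict (Set.Ioi (0 : ℝ)))) := by
    rw [integrable_prod_iff hmeas]
    constructor
    · refine Filter.Eventually.of_forall fun x => ?_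
      refine Integrable.of_integral_ne_zero ?_
      simp only [Function.uncurry_apply_pair]
      rw [hinner]
      positivity
    · have hnorm (x : V) : ∫ t in Set.Ioi (0 : ℝ), ‖Function.uncurry
          (fun (x : V) (t : ℝ) => t ^ (s - 1) * Real.exp (-((1 + ‖x‖ ^ 2) * t))) (x, t)‖ =
            Real.Gamma s * (1 + ‖x‖ ^ 2) ^ (-s) := by
        rw [← hinner]
        refine setIntegral_congr_fun measurableSet_Ioi fun t (ht : 0 < t) => ?_
        exact Real.norm_of_nonneg (by dsimp only [Function.uncurry]; positivity)
      simp_rw [hnorm]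
      refine Integrable.const_mul ?_ _
      have := integrable_rpow_neg_one_add_norm_sq (E := V) (μ := volume) (r := 2 * s)
        (by linarith)
      simpa [neg_div] using this
  have hswap := integral_integral_swap hint
  simp_rw [hinner, integral_const_mul] at hswap
  rw [eq_div_iff hΓ, mul_comm, hswap]
  have houter : ∀ t ∈ Set.Ioi (0 : ℝ),
      t ^ (s - 1) * ∫ x : V, Real.exp (-((1 + ‖x‖ ^ 2) * t)) =
        Real.pi ^ d * (t ^ (s - d - 1) * Real.exp (-(1 * t))) := by
    intro t (ht : 0 < t)
    have hexp (x : V) : Real.exp (-((1 + ‖x‖ ^ 2) * t)) =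
        Real.exp (-(1 * t)) * Real.exp (-t * ‖x‖ ^ 2) := by
      rw [← Real.exp_add]; ring_nf
    simp_rw [hexp, integral_const_mul]
    rw [GaussianFourier.integral_rexp_neg_mul_sq_norm ht, ← hd,
      Real.div_rpow Real.pi_pos.le ht.le, show s - d - 1 = (s - 1) - d by ring,
      Real.rpow_sub ht (s - 1) d]
    ring
  rw [setIntegral_congr_fun measurableSet_Ioi houter, integral_const_mul,
    Real.integral_rpow_mul_exp_neg_mul_Ioi (by linarith) one_pos]
  simp

/-- The volume of the round sphere in stereographic coordinates. -/
theorem integral_two_div_one_add_norm_sq_rpow {n : ℕ} (hn : 0 < n) :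
    ∫ x : EuclideanSpace ℝ (Fin n), (2 / (1 + ‖x‖ ^ 2)) ^ (n : ℝ) = sphereVol n := by
  have hn' : (0 : ℝ) < n := by exact_mod_cast hn
  have hrw (x : EuclideanSpace ℝ (Fin n)) : (2 / (1 + ‖x‖ ^ 2)) ^ (n : ℝ) =
      2 ^ (n : ℝ) * (1 + ‖x‖ ^ 2) ^ (-(n : ℝ)) := by
    rw [Real.div_rpow (by norm_num) (by positivity), Real.rpow_neg (by positivity), div_eq_mul_inv]
  simp_rw [hrw, integral_const_mul]
  rw [integral_one_add_norm_sq_rpow_neg (by simp; linarith), finrank_euclideanSpace_fin,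
    sphereVol]
  have hdup := Real.Gamma_mul_Gamma_add_half ((n : ℝ) / 2)
  rw [show 2 * ((n : ℝ) / 2) = n by ring, show (n : ℝ) / 2 + 1 / 2 = (n + 1) / 2 by ring,
    Real.rpow_sub two_pos, Real.rpow_one, Real.sqrt_eq_rpow] at hdup
  rw [show (n : ℝ) - n / 2 = n / 2 by ring, show ((n : ℝ) + 1) / 2 = n / 2 + 1 / 2 by ring,
    Real.rpow_add Real.pi_pos, show (n : ℝ) / 2 + 1 / 2 = (n + 1) / 2 by ring]
  have h1 : Real.Gamma n ≠ 0 := (Real.Gamma_pos_of_pos hn').ne'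
  have h2 : Real.Gamma (((n : ℝ) + 1) / 2) ≠ 0 := (Real.Gamma_pos_of_pos (by positivity)).ne'
  have h3 : (2 : ℝ) ^ (n : ℝ) ≠ 0 := by positivity
  field_simp at hdup ⊢
  linear_combination hdup

section CliffordModule

variable {n : ℕ} {H : Type*} [NormedAddCommGroup H] [InnerProductSpace ℝ H]
  {γ : EuclideanSpace ℝ (Fin n) →ₗ[ℝ] H →ₗ[ℝ] H}

theorem clifford_apply_self
    (hcl : ∀ (v w : EuclideanSpace ℝ (Fin n)) (ψ : H),
      γ v (γ w ψ) + γ w (γ v ψ) = (-2 * ⟪v, w⟫) • ψ)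
    (v : EuclideanSpace ℝ (Fin n)) (ψ : H) : γ v (γ v ψ) = (-‖v‖ ^ 2) • ψ := by
  have h := hcl v v ψ
  rw [real_inner_self_eq_norm_sq, ← two_smul ℝ, mul_comm, mul_neg, ← neg_mul, mul_comm,
    mul_smul] at h
  exact smul_right_injective H (two_ne_zero (α := ℝ)) h

theorem inner_clifford_self
    (hsk : ∀ (v : EuclideanSpace ℝ (Fin n)) (φ ψ : H), ⟪γ v φ, ψ⟫ = - ⟪φ, γ v ψ⟫)
    (v : EuclideanSpace ℝ (Fin n)) (ψ : H) : ⟪ψ, γ v ψ⟫ = 0 := by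
  have h := hsk v ψ ψ
  rw [real_inner_comm] at h
  linarith

theorem norm_clifford_sq
    (hcl : ∀ (v w : EuclideanSpace ℝ (Fin n)) (ψ : H),
      γ v (γ w ψ) + γ w (γ v ψ) = (-2 * ⟪v, w⟫) • ψ)
    (hsk : ∀ (v : EuclideanSpace ℝ (Fin n)) (φ ψ : H), ⟪γ v φ, ψ⟫ = - ⟪φ, γ v ψ⟫)
    (v : EuclideanSpace ℝ (Fin n)) (ψ : H) : ‖γ v ψ‖ ^ 2 = ‖v‖ ^ 2 * ‖ψ‖ ^ 2 := by
  rw [← real_inner_self_eq_norm_sq, hsk, clifford_apply_self hcl, real_inner_smul_right,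
    real_inner_self_eq_norm_sq]
  ring

theorem norm_add_clifford_sq
    (hcl : ∀ (v w : EuclideanSpace ℝ (Fin n)) (ψ : H),
      γ v (γ w ψ) + γ w (γ v ψ) = (-2 * ⟪v, w⟫) • ψ)
    (hsk : ∀ (v : EuclideanSpace ℝ (Fin n)) (φ ψ : H), ⟪γ v φ, ψ⟫ = - ⟪φ, γ v ψ⟫)
    {A B : H} (hAB : ‖A‖ = ‖B‖) {x : EuclideanSpace ℝ (Fin n)} (h : ⟪A, γ x B⟫ = 0) :
    ‖A + γ x B‖ ^ 2 = (1 + ‖x‖ ^ 2) * ‖A‖ ^ 2 := by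
  rw [norm_add_sq_real, h, norm_clifford_sq hcl hsk, hAB]
  ring

theorem hasFDerivAt_two_div_one_add_norm_sq_rpow (p : ℝ) (x : EuclideanSpace ℝ (Fin n)) :
    HasFDerivAt (fun y : EuclideanSpace ℝ (Fin n) => (2 / (1 + ‖y‖ ^ 2)) ^ p)
      ((-p * (2 / (1 + ‖x‖ ^ 2)) ^ (p + 1)) • innerSL ℝ x) x := by
  have hx : 0 < 1 + ‖x‖ ^ 2 := by positivity
  have h1 : HasFDerivAt (fun y : EuclideanSpace ℝ (Fin n) => 1 + ‖y‖ ^ 2)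
      (2 • innerSL ℝ x) x := (hasStrictFDerivAt_norm_sq x).hasFDerivAt.const_add 1
  have h2 : HasDerivAt (fun r : ℝ => (2 / r) ^ p)
      (-p * (2 / (1 + ‖x‖ ^ 2)) ^ (p + 1) / 2) (1 + ‖x‖ ^ 2) := by
    have h3 := ((hasDerivAt_inv hx.ne').const_mul 2).rpow_const (p := p)
      (Or.inl (by positivity))
    simp only [← div_eq_mul_inv] at h3
    convert h3 using 1
    rw [Real.rpow_add_one (by positivity), Real.rpow_sub_one (by positivity)]
    field_simp
  refine (h2.comp_hasFDerivAt x h1).congr_fderiv ?_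
  ext v
  simp
  ring

theorem dirac_conformal_smul_affine [FiniteDimensional ℝ H]
    (hcl : ∀ (v w : EuclideanSpace ℝ (Fin n)) (ψ : H),
      γ v (γ w ψ) + γ w (γ v ψ) = (-2 * ⟪v, w⟫) • ψ)
    (A B : H) (x : EuclideanSpace ℝ (Fin n)) :
    Dirac γ (fun y => ((2 / (1 + ‖y‖ ^ 2) : ℝ) ^ ((n : ℝ) / 2)) • (A + γ y B)) x =
      (-((n : ℝ) / 2) * (2 / (1 + ‖x‖ ^ 2)) ^ ((n : ℝ) / 2 + 1)) • (B + γ x A) := by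
  have hx : 0 < 1 + ‖x‖ ^ 2 := by positivity
  have hlin : HasFDerivAt (fun y => A + γ y B) (γ.flip B).toContinuousLinearMap x :=
    (γ.flip B).toContinuousLinearMap.hasFDerivAt.const_add A
  have hder := (hasFDerivAt_two_div_one_add_norm_sq_rpow ((n : ℝ) / 2) x).fun_smul hlin
  unfold Dirac
  rw [hder.fderiv]
  set g := (2 / (1 + ‖x‖ ^ 2) : ℝ) ^ ((n : ℝ) / 2)
  have hg1 : (2 / (1 + ‖x‖ ^ 2) : ℝ) ^ ((n : ℝ) / 2 + 1) = g * (2 / (1 + ‖x‖ ^ 2)) :=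
    Real.rpow_add_one (by positivity) _
  rw [hg1]
  set ψ := A + γ x B with hψ
  have hterm (i : Fin n) : γ (EuclideanSpace.single i 1)
      ((g • (γ.flip B).toContinuousLinearMap +
        ((-((n : ℝ) / 2) * (g * (2 / (1 + ‖x‖ ^ 2)))) • innerSL ℝ x).smulRight ψ)
          (EuclideanSpace.single i (1 : ℝ))) =
      (-g) • B + (-((n : ℝ) / 2) * (g * (2 / (1 + ‖x‖ ^ 2)))) •
        γ (x i • EuclideanSpace.single i (1 : ℝ)) ψ := by
    simp [clifford_apply_self hcl, EuclideanSpace.inner_single_right, mul_smul]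
  have hsum : ∑ i, x i • EuclideanSpace.single i (1 : ℝ) = x := by
    ext j
    simp [Finset.sum_apply, Pi.single_apply]
  simp_rw [hterm]
  rw [Finset.sum_add_distrib, ← Finset.smul_sum, ← Finset.smul_sum, ← LinearMap.sum_apply,
    ← map_sum, hsum, hψ,
    map_add, clifford_apply_self hcl, Finset.sum_const, Finset.card_univ, Fintype.card_fin]
  match_scalars <;> field_simp
  ring

end CliffordModule

/-- For `n ≥ 2` and `Φ₀, Φ₁ ∈ H`, not both zero, with `⟨Φ₀, Φ₁⟩ = 0`
and `⟨Φ₀, γ(v)Φ₁⟩ = 0` for all `v`, the spinor field `φ = ψ⁻_{Φ₀} + ψ⁺_{Φ₁}`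
attains the critical value of the second spinorial Sobolev quotient:
`(∫ ‖Dφ‖^{2n/(n+1)})^{(n+1)/n} = (n²/4) ωₙ^{2/n} (∫ ‖φ‖^{2n/(n−1)})^{(n−1)/n}`,
where both integrals are finite. -/
theorem bubble_combination_critical_value {n : ℕ} {H : Type*} [NormedAddCommGroup H]
    [InnerProductSpace ℝ H] [FiniteDimensional ℝ H]
    (hn : 2 ≤ n)
    (γ : EuclideanSpace ℝ (Fin n) →ₗ[ℝ] H →ₗ[ℝ] H)
    (hcl : ∀ (v w : EuclideanSpace ℝ (Fin n)) (ψ : H),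
      γ v (γ w ψ) + γ w (γ v ψ) = (-2 * ⟪v, w⟫) • ψ)
    (hsk : ∀ (v : EuclideanSpace ℝ (Fin n)) (φ ψ : H),
      ⟪γ v φ, ψ⟫ = - ⟪φ, γ v ψ⟫)
    (Φ₀ Φ₁ : H) (hΦ : ¬ (Φ₀ = 0 ∧ Φ₁ = 0)) (h01 : ⟪Φ₀, Φ₁⟫ = 0)
    (h01' : ∀ v : EuclideanSpace ℝ (Fin n), ⟪Φ₀, γ v Φ₁⟫ = 0)
    (φ : EuclideanSpace ℝ (Fin n) → H)
    (hφ : φ = fun x => psiNeg γ Φ₀ x + psiPos γ Φ₁ x) :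
    Integrable (fun x : EuclideanSpace ℝ (Fin n) =>
      ‖Dirac γ φ x‖ ^ (2 * (n : ℝ) / ((n : ℝ) + 1))) ∧
    Integrable (fun x : EuclideanSpace ℝ (Fin n) =>
      ‖φ x‖ ^ (2 * (n : ℝ) / ((n : ℝ) - 1))) ∧
    (∫ x : EuclideanSpace ℝ (Fin n),
        ‖Dirac γ φ x‖ ^ (2 * (n : ℝ) / ((n : ℝ) + 1))) ^ (((n : ℝ) + 1) / (n : ℝ)) =
      (n : ℝ) ^ 2 / 4 * sphereVol n ^ ((2 : ℝ) / (n : ℝ)) *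
        (∫ x : EuclideanSpace ℝ (Fin n),
          ‖φ x‖ ^ (2 * (n : ℝ) / ((n : ℝ) - 1))) ^ (((n : ℝ) - 1) / (n : ℝ)) := by
  have hn2 : (2 : ℝ) ≤ n := by exact_mod_cast hn
  have hn0 : (0 : ℝ) < n := by linarith
  have hn1 : (0 : ℝ) < n - 1 := by linarith
  set A := Φ₀ + Φ₁ with hA
  set B := Φ₁ - Φ₀ with hB
  have hform : φ = fun x => ((2 / (1 + ‖x‖ ^ 2) : ℝ) ^ ((n : ℝ) / 2)) • (A + γ x B) := by
    rw [hφ]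
    funext x
    rw [psiNeg, psiPos, ← smul_add, hA, hB, map_sub]
    congr 1
    abel
  have hAsq : ‖A‖ ^ 2 = ‖Φ₀‖ ^ 2 + ‖Φ₁‖ ^ 2 := by
    rw [hA, norm_add_sq_real, h01]; ring
  have hBsq : ‖B‖ ^ 2 = ‖Φ₀‖ ^ 2 + ‖Φ₁‖ ^ 2 := by
    rw [hB, norm_sub_sq_real, real_inner_comm, h01]; ring
  have hABnorm : ‖A‖ = ‖B‖ :=
    (sq_eq_sq₀ (norm_nonneg _) (norm_nonneg _)).1 (hAsq.trans hBsq.symm)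
  have hApos : 0 < ‖A‖ ^ 2 := by
    rw [hAsq]
    by_cases h : Φ₀ = 0
    · have : Φ₁ ≠ 0 := fun h' => hΦ ⟨h, h'⟩
      positivity
    · positivity
  have hAB (x : EuclideanSpace ℝ (Fin n)) : ⟪A, γ x B⟫ = 0 := by
    have h10 : ⟪Φ₁, γ x Φ₀⟫ = 0 := by
      rw [← neg_eq_zero, ← hsk, real_inner_comm, h01']
    rw [hA, hB, map_sub, inner_add_left, inner_sub_right, inner_sub_right, h01', h10,
      inner_clifford_self hsk, inner_clifford_self hsk]
    ring
  have hBA (x : EuclideanSpace ℝ (Fin n)) : ⟪B, γ x A⟫ = 0 := by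
    rw [← neg_eq_zero, ← hsk, real_inner_comm, hAB]
  set c := 2 * ‖A‖ ^ 2 with hc
  have hc0 : 0 < c := by positivity
  have hnorm {C E : H} {x : EuclideanSpace ℝ (Fin n)}
      (h : ‖C + γ x E‖ ^ 2 = (1 + ‖x‖ ^ 2) * ‖A‖ ^ 2) :
      ‖C + γ x E‖ = c ^ (1 / 2 : ℝ) * (2 / (1 + ‖x‖ ^ 2)) ^ (-(1 / 2) : ℝ) := by
    rw [Real.rpow_neg (by positivity), ← Real.inv_rpow (by positivity),
      ← Real.mul_rpow (by positivity) (by positivity), ← Real.sqrt_eq_rpow, eq_comm,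
      Real.sqrt_eq_iff_eq_sq (by positivity) (by positivity), h, hc]
    field_simp
  have hφn (x : EuclideanSpace ℝ (Fin n)) : ‖φ x‖ ^ (2 * (n : ℝ) / (n - 1)) =
      c ^ ((n : ℝ) / (n - 1)) * (2 / (1 + ‖x‖ ^ 2)) ^ (n : ℝ) := by
    have hf : 0 < 2 / (1 + ‖x‖ ^ 2) := by positivity
    rw [hform, norm_smul, Real.norm_of_nonneg (by positivity),
      hnorm (norm_add_clifford_sq hcl hsk hABnorm (hAB x)), mul_left_comm, ← Real.rpow_add hf,
      Real.mul_rpow (by positivity) (by positivity), ← Real.rpow_mul hc0.le,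
      ← Real.rpow_mul hf.le]
    congr 2 <;> field_simp
    ring
  have hDn (x : EuclideanSpace ℝ (Fin n)) : ‖Dirac γ φ x‖ ^ (2 * (n : ℝ) / (n + 1)) =
      ((n : ℝ) ^ 2 / 4 * c) ^ ((n : ℝ) / (n + 1)) * (2 / (1 + ‖x‖ ^ 2)) ^ (n : ℝ) := by
    have hf : 0 < 2 / (1 + ‖x‖ ^ 2) := by positivity
    have hsq : ((n : ℝ) ^ 2 / 4 * c) ^ (1 / 2 : ℝ) = n / 2 * c ^ (1 / 2 : ℝ) := by
      rw [Real.mul_rpow (by positivity) hc0.le, ← Real.sqrt_eq_rpow,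
        show (n : ℝ) ^ 2 / 4 = (n / 2) ^ 2 by ring, Real.sqrt_sq (by positivity)]
    rw [hform, dirac_conformal_smul_affine hcl, norm_smul, neg_mul, norm_neg,
      Real.norm_of_nonneg (by positivity), hnorm (by
        rw [norm_add_clifford_sq hcl hsk hABnorm.symm (hBA x), hABnorm]),
      mul_mul_mul_comm, ← hsq, ← Real.rpow_add hf,
      Real.mul_rpow (by positivity) (by positivity), ← Real.rpow_mul (by positivity),
      ← Real.rpow_mul hf.le]
    congr 2 <;> field_simp
    ring
  have hω := integral_two_div_one_add_norm_sq_rpow (n := n) (by omega)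
  have hωpos : 0 < sphereVol n := by
    have := Real.Gamma_pos_of_pos (s := ((n : ℝ) + 1) / 2) (by positivity)
    unfold sphereVol
    positivity
  have hint : Integrable fun x : EuclideanSpace ℝ (Fin n) => (2 / (1 + ‖x‖ ^ 2)) ^ (n : ℝ) :=
    .of_integral_ne_zero (hω ▸ hωpos.ne')
  simp_rw [hφn, hDn, integral_const_mul, hω]
  refine ⟨hint.const_mul _, hint.const_mul _, ?_⟩
  rw [Real.mul_rpow (by positivity) hωpos.le, Real.mul_rpow (by positivity) hωpos.le,
    ← Real.rpow_mul (by positivity), ← Real.rpow_mul hc0.le,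
    show (n : ℝ) / (n + 1) * ((n + 1) / n) = 1 by field_simp,
    show (n : ℝ) / (n - 1) * ((n - 1) / n) = 1 by field_simp, Real.rpow_one, Real.rpow_one,
    show ((n : ℝ) + 1) / n = 2 / n + (n - 1) / n by ring, Real.rpow_add hωpos]
  ring
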